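/- arXiv:2112.06532 — 7 statements merged into one kernel-verified Lean document; each statement's English description precedes it below -/
import Mathlib

section
/- Let δ > 0 and m ∈ ℕ, and let μ be a Borel probability measure on ℝᵈ that is δ-distributed on a standard m-arc A₁ and also δ-distributed on a standard m-arc A₂. Then A₁ = A₂. -/
open MeasureTheory Set

noncomputable section

abbrev E (d : ℕ) := EuclideanSpace ℝ (Fin d)

def mSupport {X : Type*} [TopologicalSpace X] [MeasurableSpace X] (μ : Measure X) : Set X :=
  {x | ∀ U : Set X, IsOpen U → x ∈ U → 0 < μ U}

/-- The angle `φ_m = π / (2m)`. -/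
def arcAngle (m : ℕ) : ℝ := Real.pi / (2 * m)

/-- The point `(x, y) ∈ ℝ²` (with the Euclidean metric). -/
def mk2 (x y : ℝ) : E 2 := (EuclideanSpace.equiv (Fin 2) ℝ).symm ![x, y]

/-- The vertex `v_k` of the `m`-arc with scaling factors `r`:
`v_0 = 0` and `v_i = v_{i-1} + r_i (sin(i φ_m), cos(i φ_m))`. -/
def arcVertex {m : ℕ} (r : Fin m → ℝ) (k : Fin (m + 1)) : E 2 :=
  ∑ i ∈ Finset.univ.filter fun i : Fin m => (i : ℕ) < (k : ℕ),
    r i • mk2 (Real.sin (((i : ℕ) + 1) * arcAngle m)) (Real.cos (((i : ℕ) + 1) * arcAngle m))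

/-- The `i`-th line segment `ℓ_i = [v_{i-1}, v_i]` of the `m`-arc with scaling factors `r`. -/
def arcSegment {m : ℕ} (r : Fin m → ℝ) (i : Fin m) : Set (E 2) :=
  segment ℝ (arcVertex r i.castSucc) (arcVertex r i.succ)

/-- The `m`-arc with scaling factors `r`, as a subset of `ℝ²`. -/
def arcSet {m : ℕ} (r : Fin m → ℝ) : Set (E 2) :=
  ⋃ i : Fin m, arcSegment r i

/-- `r` is the vector of scaling factors of a *standard* `m`-arc:
all `r_i > 0` and the last one satisfies `r_m = 1`. -/
def IsStdScale {m : ℕ} (r : Fin m → ℝ) : Prop :=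
  (∀ i, 0 < r i) ∧ ∀ i : Fin m, (i : ℕ) = m - 1 → r i = 1

/-- The isometric embedding of `ℝ²` onto `span{e₁, e₂} ⊆ ℝᵈ`. -/
def emb2 {d : ℕ} (x : E 2) : E d :=
  (EuclideanSpace.equiv (Fin d) ℝ).symm fun j => if h : (j : ℕ) < 2 then x ⟨j, h⟩ else 0

/-- `μ` is `δ`-distributed on the standard `m`-arc with scaling factors `r`
(the arc being viewed inside `span{e₁, e₂} ⊆ ℝᵈ`): the support of `μ` is contained in
the arc and each line segment carries mass at least `δ`. -/
def DeltaDistributed {d m : ℕ} (δ : ℝ) (μ : Measure (E d)) (r : Fin m → ℝ) : Prop :=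
  IsStdScale r ∧ mSupport μ ⊆ emb2 '' arcSet r ∧
    ∀ i : Fin m, ENNReal.ofReal δ ≤ μ (emb2 '' arcSegment r i)

/-- The linear functional on `ℝ²` vanishing on the `k`-th direction
`(sin((k+1) φ_m), cos((k+1) φ_m))` of an `m`-arc; the segment `ℓ_{k+1}` is the face of the arc
on which it is maximal. -/
def arcFunctional (m k : ℕ) : E 2 →ₗ[ℝ] ℝ where
  toFun p := p 1 * Real.sin ((k + 1) * arcAngle m) - p 0 * Real.cos ((k + 1) * arcAngle m)
  map_add' p q := by simp only [PiLp.add_apply]; ring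
  map_smul' a p := by simp only [PiLp.smul_apply, smul_eq_mul, RingHom.id_apply]; ring

lemma arcFunctional_mk2 (m k j : ℕ) :
    arcFunctional m k (mk2 (Real.sin ((j + 1) * arcAngle m)) (Real.cos ((j + 1) * arcAngle m))) =
      Real.sin (((k : ℝ) - j) * arcAngle m) := by
  have h : ((k : ℝ) - j) * arcAngle m = (k + 1) * arcAngle m - (j + 1) * arcAngle m := by ring
  rw [h, Real.sin_sub]
  simp [arcFunctional, mk2]
  ring

lemma arcFunctional_arcVertex {m : ℕ} (k : ℕ) (r : Fin m → ℝ) (c : Fin (m + 1)) :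
    arcFunctional m k (arcVertex r c) =
      ∑ i : Fin m, if (i : ℕ) < (c : ℕ) then
        r i * Real.sin (((k : ℝ) - (i : ℕ)) * arcAngle m) else 0 := by
  simp only [arcVertex, map_sum, map_smul, arcFunctional_mk2, smul_eq_mul]
  rw [Finset.sum_filter]

lemma sin_mul_arcAngle_pos {m i k : ℕ} (hik : i < k) (hk : k ≤ m) :
    0 < Real.sin (((k : ℝ) - i) * arcAngle m) := by
  have hm : (0 : ℝ) < m := by exact_mod_cast (by omega : 0 < m)
  have hik' : (i : ℝ) < k := by exact_mod_cast hik
  have hkm : (k : ℝ) ≤ m := by exact_mod_cast hk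
  have hφ : 0 < arcAngle m := by unfold arcAngle; positivity
  have hmφ : m * arcAngle m = Real.pi / 2 := by unfold arcAngle; field_simp
  apply Real.sin_pos_of_pos_of_lt_pi (mul_pos (sub_pos.2 hik') hφ)
  have : ((k : ℝ) - i) * arcAngle m ≤ m * arcAngle m := by
    gcongr
    linarith [(Nat.cast_nonneg i : (0 : ℝ) ≤ i)]
  linarith [Real.pi_pos]

lemma arcFunctional_arcVertex_le {m : ℕ} {r : Fin m → ℝ} (hr : ∀ i, 0 < r i) (k : Fin m)
    (c : Fin (m + 1)) :
    arcFunctional m k (arcVertex r c) ≤ arcFunctional m k (arcVertex r k.castSucc) := by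
  rw [arcFunctional_arcVertex, arcFunctional_arcVertex]
  refine Finset.sum_le_sum fun i _ => ?_
  rw [Fin.val_castSucc]
  rcases lt_or_ge (i : ℕ) (k : ℕ) with hik | hik
  · have := mul_pos (hr i) (sin_mul_arcAngle_pos hik k.2.le)
    split_ifs <;> linarith
  · have hneg : r i * Real.sin (((k : ℕ) - (i : ℕ) : ℝ) * arcAngle m) ≤ 0 := by
      rcases hik.eq_or_lt with h | h
      · simp [h]
      · have := mul_pos (hr i) (sin_mul_arcAngle_pos h i.2.le)
        rw [← neg_sub ((i : ℕ) : ℝ), neg_mul, Real.sin_neg]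
        linarith
    split_ifs <;> first | omega | linarith

lemma arcFunctional_le_of_mem_arcSet {m : ℕ} {r : Fin m → ℝ} (hr : ∀ i, 0 < r i) (k : Fin m)
    {p : E 2} (hp : p ∈ arcSet r) :
    arcFunctional m k p ≤ arcFunctional m k (arcVertex r k.castSucc) := by
  obtain ⟨i, a, b, ha, hb, hab, rfl⟩ := mem_iUnion.1 hp
  simp only [map_add, map_smul, smul_eq_mul]
  have h₁ := arcFunctional_arcVertex_le hr k i.castSucc
  have h₂ := arcFunctional_arcVertex_le hr k i.succ
  obtain rfl : b = 1 - a := by linarith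
  nlinarith [mul_le_mul_of_nonneg_left h₁ ha, mul_le_mul_of_nonneg_left h₂ hb]

lemma arcFunctional_of_mem_arcSegment {m : ℕ} {r : Fin m → ℝ} (k : Fin m)
    {p : E 2} (hp : p ∈ arcSegment r k) :
    arcFunctional m k p = arcFunctional m k (arcVertex r k.castSucc) := by
  obtain ⟨a, b, ha, hb, hab, rfl⟩ := hp
  have h : arcFunctional m k (arcVertex r k.succ) =
      arcFunctional m k (arcVertex r k.castSucc) := by
    rw [arcFunctional_arcVertex, arcFunctional_arcVertex]
    refine Finset.sum_congr rfl fun i _ => ?_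
    rw [Fin.val_castSucc, Fin.val_succ]
    rcases lt_trichotomy (i : ℕ) (k : ℕ) with hik | hik | hik
    · simp [hik, hik.trans (Nat.lt_succ_self _)]
    · simp [hik]
    · rw [if_neg (by omega), if_neg (by omega)]
  simp only [map_add, map_smul, smul_eq_mul, h]
  rw [← add_mul, hab, one_mul]

/-- The support values of a standard arc in the directions normal to its segments determine
its scaling factors. -/
lemma eq_of_arcFunctional_eq {m : ℕ} {r₁ r₂ : Fin m → ℝ}
    (hr : ∀ i : Fin m, (i : ℕ) = m - 1 → r₁ i = r₂ i)
    (h : ∀ k : Fin m, arcFunctional m k (arcVertex r₁ k.castSucc) =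
      arcFunctional m k (arcVertex r₂ k.castSucc)) : r₁ = r₂ := by
  have key : ∀ n (hn : n < m), r₁ ⟨n, hn⟩ = r₂ ⟨n, hn⟩ := by
    intro n
    induction n using Nat.strong_induction_on with
    | _ n ih =>
      intro hn
      rcases Nat.lt_or_ge (n + 1) m with hlt | hge
      · have hk := h ⟨n + 1, hlt⟩
        rw [arcFunctional_arcVertex, arcFunctional_arcVertex, ← sub_eq_zero,
          ← Finset.sum_sub_distrib, Finset.sum_eq_single ⟨n, hn⟩] at hk
        · have hs := sin_mul_arcAngle_pos (Nat.lt_succ_self n) hlt.le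
          simp only [Fin.val_castSucc, Nat.lt_succ_self, if_true, ← sub_mul] at hk
          exact sub_eq_zero.1 ((mul_eq_zero.1 hk).resolve_right hs.ne')
        · intro i _ hi
          rcases lt_trichotomy (i : ℕ) n with hin | hin | hin
          · rw [show r₁ i = r₂ i from ih i hin i.2, sub_self]
          · exact absurd (Fin.ext hin) hi
          · have hni : ¬ (i : ℕ) < n + 1 := by omega
            simp [hni]
        · simp
      · exact hr _ (by simp only; omega)
  exact funext fun i => key i i.2

lemma emb2_injective {d : ℕ} (hd : 2 ≤ d) : Function.Injective (emb2 : E 2 → E d) := by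
  intro x y hxy
  ext i
  have := congrArg (fun z : E d => z ⟨i, i.2.trans_le hd⟩) hxy
  simpa [emb2, Nat.le_of_lt_succ i.2] using this

lemma inter_mSupport_nonempty {X : Type*} [TopologicalSpace X] [SecondCountableTopology X]
    [MeasurableSpace X] {μ : Measure X} {s : Set X} (hs : 0 < μ s) :
    (s ∩ mSupport μ).Nonempty := by
  by_contra hne
  refine hs.ne' (measure_null_of_locally_null s fun x hx => ?_)
  have hx' : x ∉ mSupport μ := fun h => hne ⟨x, hx, h⟩
  simp only [mSupport, mem_ofPred_eq, not_forall, not_lt, nonpos_iff_eq_zero] at hx'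
  obtain ⟨U, hU, hxU, hμ⟩ := hx'
  exact ⟨U, mem_nhdsWithin_of_mem_nhds (hU.mem_nhds hxU), hμ⟩

lemma arcFunctional_le_of_deltaDistributed {d m : ℕ} (hd : 2 ≤ d) {δ : ℝ} (hδ : 0 < δ)
    {μ : Measure (E d)} {r₁ r₂ : Fin m → ℝ}
    (h₁ : DeltaDistributed δ μ r₁) (h₂ : DeltaDistributed δ μ r₂) (k : Fin m) :
    arcFunctional m k (arcVertex r₁ k.castSucc) ≤
      arcFunctional m k (arcVertex r₂ k.castSucc) := by
  obtain ⟨_, ⟨p, hp, rfl⟩, hsupp⟩ :=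
    inter_mSupport_nonempty ((ENNReal.ofReal_pos.2 hδ).trans_le (h₁.2.2 k))
  have hp₂ : p ∈ arcSet r₂ := (emb2_injective hd).mem_set_image.1 (h₂.2.1 hsupp)
  rw [← arcFunctional_of_mem_arcSegment k hp]
  exact arcFunctional_le_of_mem_arcSet h₂.1.1 k hp₂

/-- A probability measure on `ℝᵈ` can be `δ`-distributed (with `δ > 0`) on at most one
standard `m`-arc: if it is `δ`-distributed on the standard arcs with scaling factors
`r₁` and `r₂`, then `r₁ = r₂` (in particular the two arcs coincide). -/
theorem arc_unique {d m : ℕ} (hd : 2 ≤ d) {δ : ℝ} (hδ : 0 < δ)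
    (μ : Measure (E d)) [IsProbabilityMeasure μ]
    (r₁ r₂ : Fin m → ℝ)
    (h₁ : DeltaDistributed δ μ r₁) (h₂ : DeltaDistributed δ μ r₂) :
    r₁ = r₂ := by
  refine eq_of_arcFunctional_eq (fun i hi => (h₁.1.2 i hi).trans (h₂.1.2 i hi).symm) fun k => ?_
  exact le_antisymm (arcFunctional_le_of_deltaDistributed hd hδ h₁ h₂ k)
    (arcFunctional_le_of_deltaDistributed hd hδ h₂ h₁ k)

end
end

section
/- Let d ≥ 2, Ω ⊆ ℝⁿ, and let p : Ω → D(ℝᵈ) be a ReLU-invariant family of probability distributions such that there exists θ₀ ∈ Ω for which supp(p(θ₀)) is infinite. Then for every m ∈ ℕ there exists δ > 0 such that for every standard m-arc A there exists θ ∈ Ω with p(θ) δ-distributed on A; in particular, for every choice of scaling factors (r₁,…,r_{m−1}) ∈ ℝ₊^{m−1} the family contains a measure δ-distributed on the standard m-arc with scaling factors (r₁,…,r_{m−1},1). -/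
open MeasureTheory Set

noncomputable section

/-- The ReLU layer `x ↦ ϱ(Wx + b)` with `ϱ(t) = max {0, t}` applied componentwise. -/
def reluLayer {d : ℕ} (W : Matrix (Fin d) (Fin d) ℝ) (b : Fin d → ℝ) (x : E d) : E d :=
  (EuclideanSpace.equiv (Fin d) ℝ).symm fun i => max (W.mulVec x i + b i) 0

/-- `f` is a ReLU layer, i.e. of the form `x ↦ ϱ(Wx + b)`. -/
def IsReLULayer {d : ℕ} (f : E d → E d) : Prop :=
  ∃ (W : Matrix (Fin d) (Fin d) ℝ) (b : Fin d → ℝ), f = reluLayer W b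

/-- A composition of finitely many (at least one) ReLU layers. -/
inductive IsReLUNet {d : ℕ} : (E d → E d) → Prop
  | layer (W : Matrix (Fin d) (Fin d) ℝ) (b : Fin d → ℝ) : IsReLUNet (reluLayer W b)
  | comp (W : Matrix (Fin d) (Fin d) ℝ) (b : Fin d → ℝ) {f : E d → E d} (hf : IsReLUNet f) :
      IsReLUNet (reluLayer W b ∘ f)

/-- The map into `span{e₁, e₂}` with coordinate functions `u` and `v`. -/
def planeMap {d : ℕ} (u v : E d → ℝ) (z : E d) : E d := emb2 (mk2 (u z) (v z))

lemma mk2_apply_zero (x y : ℝ) : mk2 x y 0 = x := rfl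

lemma mk2_apply_one (x y : ℝ) : mk2 x y 1 = y := rfl

lemma reluLayer_apply {d : ℕ} (W : Matrix (Fin d) (Fin d) ℝ) (b : Fin d → ℝ) (x : E d)
    (i : Fin d) : reluLayer W b x i = max ((∑ j, W i j * x j) + b i) 0 := rfl

lemma emb2_apply {d : ℕ} (x : E 2) (j : Fin d) :
    (emb2 x : E d) j = if h : (j : ℕ) < 2 then x ⟨j, h⟩ else 0 := rfl

lemma continuous_emb2 {d : ℕ} : Continuous (emb2 : E 2 → E d) := by
  refine (EuclideanSpace.equiv (Fin d) ℝ).symm.continuous.comp (continuous_pi fun j => ?_)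
  by_cases h : (j : ℕ) < 2 <;> simp only [h, dite_true, dite_false] <;> fun_prop

lemma continuous_reluLayer {d : ℕ} (W : Matrix (Fin d) (Fin d) ℝ) (b : Fin d → ℝ) :
    Continuous (reluLayer W b) := by
  refine (EuclideanSpace.equiv (Fin d) ℝ).symm.continuous.comp (continuous_pi fun i => ?_)
  change Continuous fun x : E d => max ((∑ j, W i j * x j) + b i) 0
  fun_prop

namespace IsReLUNet

variable {d : ℕ} {u v : E d → ℝ}

lemma continuous {f : E d → E d} (hf : IsReLUNet f) : Continuous f := by
  induction hf with
  | layer W b => exact continuous_reluLayer W b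
  | comp W b _ ih => exact (continuous_reluLayer W b).comp ih

/-- An invariant family is also invariant under compositions of ReLU layers. -/
lemma exists_map_eq {Ω : Type*} {p : Ω → ProbabilityMeasure (E d)}
    (hinv : ∀ f : E d → E d, IsReLULayer f → ∀ θ : Ω, ∃ ω : Ω,
      (p ω : Measure (E d)) = (p θ : Measure (E d)).map f)
    {f : E d → E d} (hf : IsReLUNet f) (θ : Ω) :
    ∃ ω : Ω, (p ω : Measure (E d)) = (p θ : Measure (E d)).map f := by
  induction hf with
  | layer W b => exact hinv _ ⟨W, b, rfl⟩ θ
  | comp W b hf ih =>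
    obtain ⟨ω, hω⟩ := ih
    obtain ⟨η, hη⟩ := hinv _ ⟨W, b, rfl⟩ ω
    exact ⟨η, by rw [hη, hω, Measure.map_map (continuous_reluLayer W b).measurable
      hf.continuous.measurable]⟩

lemma coordinate (i : Fin d) (c : ℝ) :
    IsReLUNet (planeMap (fun z : E d => max (z i + c) 0) (fun _ => 0)) := by
  convert layer (.of fun k j => if (k : ℕ) = 0 ∧ j = i then 1 else 0)
    (fun k => if (k : ℕ) = 0 then c else 0) using 1
  ext z k
  rw [planeMap, emb2_apply, reluLayer_apply]
  by_cases h0 : (k : ℕ) = 0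
  · have h : (⟨k, by omega⟩ : Fin 2) = 0 := Fin.ext h0
    simp [h0, mk2_apply_zero]
  · by_cases h1 : (k : ℕ) = 1
    · simp [h1, mk2_apply_one]
    · have h : ¬ (k : ℕ) < 2 := by omega
      simp [h, h0]

/-- A ReLU layer may be applied to the first two coordinates of a network. -/
lemma affine (hd : 2 ≤ d) (h : IsReLUNet (planeMap u v)) (a b c a' b' c' : ℝ) :
    IsReLUNet (planeMap (fun z => max (a * u z + b * v z + c) 0)
      (fun z => max (a' * u z + b' * v z + c') 0)) := by
  obtain ⟨k, rfl⟩ := Nat.exists_eq_add_of_le' hd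
  convert comp (.of (Fin.cons (Fin.cons a (Fin.cons b 0))
      (Fin.cons (Fin.cons a' (Fin.cons b' 0)) 0)))
    (Fin.cons c (Fin.cons c' 0)) h using 1
  ext z i
  rw [Function.comp_apply, reluLayer_apply, Fin.sum_univ_succ, Fin.sum_univ_succ]
  simp only [planeMap, emb2_apply]
  refine Fin.cases ?_ (fun i => Fin.cases ?_ (fun i => ?_) i) i
  · simp [mk2_apply_zero, mk2_apply_one]
  · simp [mk2_apply_zero, mk2_apply_one]
  · simp

lemma max_line (hd : 2 ≤ d) (h : IsReLUNet (planeMap u v)) (hu : ∀ z, 0 ≤ u z)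
    (hv : ∀ z, 0 ≤ v z) (a c : ℝ) :
    IsReLUNet (planeMap u (fun z => max (v z) (a * u z + c))) := by
  convert (h.affine hd 1 0 0 (-a) 1 (-c)).affine hd 1 0 0 a 1 c using 2 <;> funext z
  · simp [hu z]
  · have := hu z
    have := hv z
    simp only [one_mul, zero_mul, add_zero, max_eq_left (hu z)]
    rcases le_total (v z) (a * u z + c) with h | h
    · rw [max_eq_right h, max_eq_right (by linarith : -a * u z + v z + -c ≤ 0),
        max_eq_left (by linarith)]
      ring
    · rw [max_eq_left h, max_eq_left (by linarith : 0 ≤ -a * u z + v z + -c),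
        max_eq_left (by linarith)]
      ring

lemma min_line (hd : 2 ≤ d) (h : IsReLUNet (planeMap u v)) (hu : ∀ z, 0 ≤ u z)
    (hv : ∀ z, 0 ≤ v z) {a c : ℝ} (hl : ∀ z, 0 ≤ a * u z + c) :
    IsReLUNet (planeMap u (fun z => min (v z) (a * u z + c))) := by
  convert (h.affine hd 1 0 0 a (-1) c).affine hd 1 0 0 a (-1) c using 2 <;> funext z
  · simp [hu z]
  · have := hl z
    have := hv z
    simp only [one_mul, zero_mul, add_zero, max_eq_left (hu z)]
    rcases le_total (v z) (a * u z + c) with h | h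
    · rw [min_eq_left h, max_eq_left (by linarith : 0 ≤ a * u z + -1 * v z + c),
        max_eq_left (by linarith)]
      ring
    · rw [min_eq_right h, max_eq_right (by linarith : a * u z + -1 * v z + c ≤ 0),
        max_eq_left (by linarith)]
      ring

/-- A network can realise staircase functions of its first coordinate, with value `c j` on
`[A j, B j]`. -/
lemma exists_staircase (hd : 2 ≤ d) (h : IsReLUNet (planeMap u fun _ => 0))
    (hu : ∀ z, 0 ≤ u z) (A B c : ℕ → ℝ) (hc : Monotone c) (hc0 : c 0 = 0) (k : ℕ)
    (hB : ∀ i j, i ≤ j → j ≤ k → B i ≤ B j) (hBA : ∀ j < k, B j < A (j + 1)) :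
    ∃ y : E d → ℝ, IsReLUNet (planeMap u y) ∧ ∀ z, 0 ≤ y z ∧ y z ≤ c k ∧
      (A k ≤ u z → y z = c k) ∧ ∀ j ≤ k, A j ≤ u z → u z ≤ B j → y z = c j := by
  induction k with
  | zero =>
    refine ⟨fun _ => 0, h, fun z => ?_⟩
    simp [hc0]
  | succ k ih =>
    obtain ⟨y, hy, hyp⟩ := ih (fun i j hij hj => hB i j hij (by omega))
      (fun j hj => hBA j (by omega))
    have hcn : ∀ j, 0 ≤ c j := fun j => hc0 ▸ hc (Nat.zero_le j)
    have hgap : 0 < A (k + 1) - B k := sub_pos.2 (hBA k (by omega))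
    set a : ℝ := c (k + 1) / (A (k + 1) - B k) with ha
    have han : 0 ≤ a := div_nonneg (hcn _) hgap.le
    have haA : a * (A (k + 1) - B k) = c (k + 1) := div_mul_cancel₀ _ hgap.ne'
    have hmax := hy.max_line hd hu (fun z => (hyp z).1) a (-(a * B k))
    refine ⟨_, hmax.min_line hd hu (fun z => le_max_of_le_left (hyp z).1) (a := 0)
      (c := c (k + 1)) (fun z => by simpa using hcn _), fun z => ?_⟩
    obtain ⟨h0, h1, h2, h3⟩ := hyp z
    have hck := hc (Nat.le_succ k)
    have hbig : A (k + 1) ≤ u z →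
        min (max (y z) (a * u z + -(a * B k))) (0 * u z + c (k + 1)) = c (k + 1) := by
      intro hz
      rw [zero_mul, zero_add]
      refine min_eq_right (le_max_of_le_right ?_)
      nlinarith [mul_le_mul_of_nonneg_left hz han]
    refine ⟨le_min (le_max_of_le_left h0) (by simpa using hcn _), ?_, hbig, fun j hj hAj hBj => ?_⟩
    · exact (min_le_right _ _).trans (by simp)
    · rcases Nat.lt_or_ge k j with hkj | hkj
      · obtain rfl : j = k + 1 := by omega
        exact hbig hAj
      · have hz : u z ≤ B k := hBj.trans (hB j k hkj (by omega))
        rw [max_eq_left, min_eq_left, h3 j hkj hAj hBj]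
        · rw [zero_mul, zero_add]
          exact h1.trans hck
        · nlinarith [mul_le_mul_of_nonneg_left hz han]

/-- A network can realise the concave piecewise linear function of its first coordinate with
breakpoints `(X j, V j)` and slopes `s j`. -/
lemma exists_concave (hd : 2 ≤ d) (h : IsReLUNet (planeMap u fun _ => 0))
    (hu : ∀ z, 0 ≤ u z) (X V s : ℕ → ℝ) (hX0 : X 0 = 0) (hV0 : V 0 = 0) (hX : Monotone X)
    (hVn : ∀ j, 0 ≤ V j) (hs : Antitone s) (hsn : ∀ j, 0 ≤ s j)
    (hV : ∀ j, V (j + 1) = V j + s j * (X (j + 1) - X j)) (k : ℕ) :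
    ∃ y : E d → ℝ, IsReLUNet (planeMap u y) ∧ ∀ z, 0 ≤ y z ∧ y z ≤ V k + s k * (u z - X k) ∧
      (X k ≤ u z → y z = V k + s k * (u z - X k)) ∧
      ∀ i ≤ k, X i ≤ u z → u z ≤ X (i + 1) → y z = V i + s i * (u z - X i) := by
  induction k with
  | zero =>
    refine ⟨_, h.max_line hd hu (fun _ => le_rfl) (s 0) 0, fun z => ?_⟩
    have := mul_nonneg (hsn 0) (hu z)
    simp [hX0, hV0, this]
  | succ k ih =>
    obtain ⟨y, hy, hyp⟩ := ih
    have hdiff : ∀ z, V (k + 1) + s (k + 1) * (u z - X (k + 1)) - (V k + s k * (u z - X k)) =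
        (s k - s (k + 1)) * (X (k + 1) - u z) := fun z => by rw [hV]; ring
    have hsk : 0 ≤ s k - s (k + 1) := sub_nonneg.2 (hs (Nat.le_succ k))
    have hle : ∀ z, u z ≤ X (k + 1) → y z ≤ V (k + 1) + s (k + 1) * (u z - X (k + 1)) :=
      fun z hz => by
        have := hdiff z
        have := mul_nonneg hsk (sub_nonneg.2 hz)
        have := (hyp z).2.1
        linarith
    have hline : ∀ z, s (k + 1) * u z + (V (k + 1) - s (k + 1) * X (k + 1)) =
        V (k + 1) + s (k + 1) * (u z - X (k + 1)) := fun z => by ring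
    have hnn : ∀ z, 0 ≤ V (k + 1) + s (k + 1) * (u z - X (k + 1)) := fun z => by
      rcases le_total (u z) (X (k + 1)) with hz | hz
      · exact (hyp z).1.trans (hle z hz)
      · exact add_nonneg (hVn _) (mul_nonneg (hsn _) (sub_nonneg.2 hz))
    refine ⟨_, hy.min_line hd hu (fun z => (hyp z).1) (fun z => (hline z).symm ▸ hnn z),
      fun z => ?_⟩
    rw [hline]
    obtain ⟨h0, h1, h2, h3⟩ := hyp z
    have hbig : X (k + 1) ≤ u z → min (y z) (V (k + 1) + s (k + 1) * (u z - X (k + 1))) =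
        V (k + 1) + s (k + 1) * (u z - X (k + 1)) := fun hz => by
      refine min_eq_right ?_
      rw [h2 ((hX (Nat.le_succ k)).trans hz)]
      have := hdiff z
      have := mul_nonneg hsk (sub_nonneg.2 hz)
      nlinarith
    refine ⟨le_min h0 (hnn z), min_le_right _ _, hbig, fun i hi hXi hXi' => ?_⟩
    rcases Nat.lt_or_ge k i with hki | hki
    · obtain rfl : i = k + 1 := by omega
      exact hbig hXi
    · rw [min_eq_left (hle z (hXi'.trans (hX (by omega)))), h3 i hki hXi hXi']

end IsReLUNet

/-- The direction angle of the `i`-th arc segment, frozen at `π / 2` for `i ≥ m`. -/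
def segmentAngle (m i : ℕ) : ℝ := (min (i + 1) m : ℕ) * arcAngle m

lemma segmentAngle_pos {m : ℕ} (hm : 0 < m) (i : ℕ) : 0 < segmentAngle m i := by
  have : 0 < min (i + 1) m := by omega
  have : (0 : ℝ) < m := by exact_mod_cast hm
  unfold segmentAngle arcAngle
  positivity

lemma segmentAngle_le {m : ℕ} (hm : 0 < m) (i : ℕ) : segmentAngle m i ≤ Real.pi / 2 := by
  have hm' : (0 : ℝ) < m := by exact_mod_cast hm
  have h : ((min (i + 1) m : ℕ) : ℝ) ≤ m := by exact_mod_cast min_le_right _ _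
  have : 0 < arcAngle m := by unfold arcAngle; positivity
  calc segmentAngle m i ≤ m * arcAngle m := mul_le_mul_of_nonneg_right h this.le
    _ = Real.pi / 2 := by unfold arcAngle; field_simp

lemma monotone_segmentAngle (m : ℕ) : Monotone (segmentAngle m) := fun i j hij => by
  have : 0 ≤ arcAngle m := by unfold arcAngle; positivity
  refine mul_le_mul_of_nonneg_right ?_ this
  exact_mod_cast min_le_min_right m (by omega)

lemma sin_segmentAngle_pos {m : ℕ} (hm : 0 < m) (i : ℕ) : 0 < Real.sin (segmentAngle m i) :=
  Real.sin_pos_of_pos_of_lt_pi (segmentAngle_pos hm i)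
    (by linarith [segmentAngle_le hm i, Real.pi_pos])

lemma cos_segmentAngle_nonneg {m : ℕ} (hm : 0 < m) (i : ℕ) : 0 ≤ Real.cos (segmentAngle m i) :=
  Real.cos_nonneg_of_neg_pi_div_two_le_of_le
    (by linarith [segmentAngle_pos hm i, Real.pi_pos]) (segmentAngle_le hm i)

lemma antitone_cot_segmentAngle {m : ℕ} (hm : 0 < m) :
    Antitone fun i => Real.cos (segmentAngle m i) / Real.sin (segmentAngle m i) := fun i j hij => by
  change Real.cos (segmentAngle m j) / Real.sin (segmentAngle m j) ≤
    Real.cos (segmentAngle m i) / Real.sin (segmentAngle m i)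
  rw [div_le_div_iff₀ (sin_segmentAngle_pos hm j) (sin_segmentAngle_pos hm i)]
  have h : 0 ≤ Real.sin (segmentAngle m j - segmentAngle m i) :=
    Real.sin_nonneg_of_nonneg_of_le_pi (sub_nonneg.2 (monotone_segmentAngle m hij))
      (by linarith [segmentAngle_le hm j, segmentAngle_pos hm i, Real.pi_pos])
  rw [Real.sin_sub] at h
  linarith

/-- The scaling factors of an arc, extended by zero. -/
def extScale {m : ℕ} (r : Fin m → ℝ) (i : ℕ) : ℝ := if h : i < m then r ⟨i, h⟩ else 0

lemma extScale_nonneg {m : ℕ} {r : Fin m → ℝ} (hr : ∀ i, 0 < r i) (i : ℕ) : 0 ≤ extScale r i := by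
  unfold extScale
  split_ifs
  exacts [(hr _).le, le_rfl]

/-- The first coordinate of the `k`-th vertex of an arc. -/
def arcX {m : ℕ} (r : Fin m → ℝ) (k : ℕ) : ℝ :=
  ∑ i ∈ Finset.range k, extScale r i * Real.sin (segmentAngle m i)

/-- The second coordinate of the `k`-th vertex of an arc. -/
def arcY {m : ℕ} (r : Fin m → ℝ) (k : ℕ) : ℝ :=
  ∑ i ∈ Finset.range k, extScale r i * Real.cos (segmentAngle m i)

lemma arcVertex_apply {m : ℕ} (r : Fin m → ℝ) (k : Fin (m + 1)) :
    arcVertex r k 0 = arcX r k ∧ arcVertex r k 1 = arcY r k := by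
  have key : ∀ g : ℝ → ℝ,
      ∑ i ∈ Finset.univ.filter (fun i : Fin m => (i : ℕ) < (k : ℕ)),
        r i * g (((i : ℕ) + 1) * arcAngle m) =
      ∑ i ∈ Finset.range k, extScale r i * g (segmentAngle m i) := by
    intro g
    refine Finset.sum_bij (fun i _ => (i : ℕ)) (by simp) (by simp [Fin.ext_iff]) ?_ ?_
    · intro i hi
      have hi := Finset.mem_range.1 hi
      exact ⟨⟨i, by omega⟩, by simpa using hi, rfl⟩
    · intro i _
      simp [extScale, segmentAngle]
  constructor
  · rw [arcX, ← key]
    simp [arcVertex, mk2_apply_zero]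
  · rw [arcY, ← key]
    simp [arcVertex, mk2_apply_one]

lemma monotone_arcX {m : ℕ} (hm : 0 < m) {r : Fin m → ℝ} (hr : ∀ i, 0 < r i) :
    Monotone (arcX r) := monotone_nat_of_le_succ fun k => by
  rw [arcX, arcX, Finset.sum_range_succ]
  exact le_add_of_nonneg_right (mul_nonneg (extScale_nonneg hr k) (sin_segmentAngle_pos hm k).le)

lemma arcX_lt_succ {m : ℕ} {r : Fin m → ℝ} (hr : ∀ i, 0 < r i) {k : ℕ} (hk : k < m) :
    arcX r k < arcX r (k + 1) := by
  rw [arcX, arcX, Finset.sum_range_succ, extScale, dif_pos hk]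
  exact lt_add_of_pos_right _ (mul_pos (hr _) (sin_segmentAngle_pos (by omega) k))

lemma arcY_nonneg {m : ℕ} (hm : 0 < m) {r : Fin m → ℝ} (hr : ∀ i, 0 < r i) (k : ℕ) :
    0 ≤ arcY r k :=
  Finset.sum_nonneg fun i _ => mul_nonneg (extScale_nonneg hr i) (cos_segmentAngle_nonneg hm i)

lemma arcY_succ {m : ℕ} (hm : 0 < m) (r : Fin m → ℝ) (k : ℕ) :
    arcY r (k + 1) = arcY r k + Real.cos (segmentAngle m k) / Real.sin (segmentAngle m k) *
      (arcX r (k + 1) - arcX r k) := by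
  have := (sin_segmentAngle_pos hm k).ne'
  rw [arcY, arcX, Finset.sum_range_succ, Finset.sum_range_succ, ← arcX, ← arcY]
  field_simp
  ring

lemma mk2_mem_arcSegment {m : ℕ} {r : Fin m → ℝ} (hr : ∀ i, 0 < r i) (i : Fin m) {x : ℝ}
    (h₁ : arcX r i ≤ x) (h₂ : x ≤ arcX r (i + 1)) :
    mk2 x (arcY r i + Real.cos (segmentAngle m i) / Real.sin (segmentAngle m i) *
      (x - arcX r i)) ∈ arcSegment r i := by
  have hlt := sub_pos.2 (arcX_lt_succ hr i.2)
  have ha := arcVertex_apply r i.castSucc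
  have hb := arcVertex_apply r i.succ
  have hY := arcY_succ i.pos r i
  simp only [Fin.val_castSucc, Fin.val_succ] at ha hb
  rw [arcSegment, segment_eq_image']
  refine ⟨(x - arcX r i) / (arcX r (i + 1) - arcX r i),
    ⟨div_nonneg (sub_nonneg.2 h₁) hlt.le, (div_le_one hlt).2 (by linarith)⟩, ?_⟩
  ext j
  fin_cases j
  · simp [ha.1, hb.1, mk2_apply_zero, div_mul_cancel₀ _ hlt.ne']
  · simp only [Fin.mk_one, Fin.isValue, PiLp.add_apply, PiLp.smul_apply, PiLp.sub_apply, ha.2, hb.2,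
      hY, smul_eq_mul, mk2_apply_one]
    field_simp
    ring

lemma isClosed_emb2_image_arcSet {d m : ℕ} (r : Fin m → ℝ) :
    IsClosed ((emb2 : E 2 → E d) '' arcSet r) := by
  refine IsCompact.isClosed (IsCompact.image (isCompact_iUnion fun i => ?_) continuous_emb2)
  rw [arcSegment, segment_eq_image']
  exact isCompact_Icc.image (by fun_prop)

lemma exists_mem_Icc_succ {X : ℕ → ℝ} {x : ℝ} (h₀ : X 0 ≤ x) {m : ℕ} (hm : 0 < m)
    (h : x ≤ X m) : ∃ i < m, X i ≤ x ∧ x ≤ X (i + 1) := by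
  induction m, hm using Nat.le_induction with
  | base => exact ⟨0, by omega, h₀, h⟩
  | succ m hm ih =>
    rcases le_total x (X m) with hx | hx
    · obtain ⟨i, hi, hi'⟩ := ih hx
      exact ⟨i, by omega, hi'⟩
    · exact ⟨m, by omega, hx, h⟩

/-- For prescribed separated intervals `[A j, B j]` there is a
network into the arc mapping `{A j ≤ u ≤ B j}` into the `j`-th segment. -/
lemma exists_net_onto_arc {d m : ℕ} (hd : 2 ≤ d) (hm : 0 < m) {r : Fin m → ℝ}
    (hr : ∀ i, 0 < r i) {u : E d → ℝ} (h : IsReLUNet (planeMap u fun _ => 0))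
    (hu : ∀ z, 0 ≤ u z) (A B : ℕ → ℝ) (hB : ∀ i j, i ≤ j → j < m → B i ≤ B j)
    (hBA : ∀ j, j + 1 < m → B j < A (j + 1)) :
    ∃ f : E d → E d, IsReLUNet f ∧ (∀ z, f z ∈ emb2 '' arcSet r) ∧
      ∀ i : Fin m, ∀ z, A i ≤ u z → u z ≤ B i → f z ∈ emb2 '' arcSegment r i := by
  have hX0 : arcX r 0 = 0 := by simp [arcX]
  obtain ⟨x, hx, hxp⟩ := h.exists_staircase hd hu A B (arcX r) (monotone_arcX hm hr) hX0 (m - 1)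
    (fun i j hij hj => hB i j hij (by omega)) (fun j hj => hBA j (by omega))
  have hxn : ∀ z, 0 ≤ x z := fun z => (hxp z).1
  have hx' : IsReLUNet (planeMap x fun _ => 0) := by
    simpa [hxn] using hx.affine hd 0 1 0 0 0 0
  obtain ⟨y, hy, hyp⟩ := hx'.exists_concave hd hxn (arcX r) (arcY r)
    (fun i => Real.cos (segmentAngle m i) / Real.sin (segmentAngle m i)) hX0 (by simp [arcY])
    (monotone_arcX hm hr) (arcY_nonneg hm hr) (antitone_cot_segmentAngle hm)
    (fun i => div_nonneg (cos_segmentAngle_nonneg hm i) (sin_segmentAngle_pos hm i).le)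
    (arcY_succ hm r) (m - 1)
  have key : ∀ (i : Fin m) z, arcX r i ≤ x z → x z ≤ arcX r (i + 1) →
      planeMap x y z ∈ emb2 '' arcSegment r i := fun i z h₁ h₂ => by
    refine ⟨_, ?_, rfl⟩
    rw [(hyp z).2.2.2 i (by omega) h₁ h₂]
    exact mk2_mem_arcSegment hr i h₁ h₂
  refine ⟨_, hy, fun z => ?_, fun i z h₁ h₂ => ?_⟩
  · obtain ⟨i, hi, h₁, h₂⟩ := exists_mem_Icc_succ (X := arcX r) (x := x z) (hX0 ▸ hxn z) hm
      ((hxp z).2.1.trans (monotone_arcX hm hr (by omega)))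
    exact image_mono (subset_iUnion (arcSegment r) ⟨i, hi⟩) (key ⟨i, hi⟩ z h₁ h₂)
  · have hz := (hxp z).2.2.2 i (by omega) h₁ h₂
    exact key i z hz.ge (hz.trans_le (monotone_arcX hm hr (by omega)))

lemma mSupport_map_subset {X Y : Type*} [TopologicalSpace X] [MeasurableSpace X]
    [TopologicalSpace Y] [MeasurableSpace Y] [OpensMeasurableSpace Y] (μ : Measure X) {f : X → Y}
    (hf : Measurable f) {K : Set Y} (hK : IsClosed K) (h : ∀ z, f z ∈ K) :
    mSupport (μ.map f) ⊆ K := by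
  intro w hw
  by_contra hwK
  have := hw Kᶜ hK.isOpen_compl hwK
  rw [Measure.map_apply hf hK.isOpen_compl.measurableSet] at this
  simp [preimage, h] at this

/-- An infinite subset of `ℝ^d` has arbitrarily many points with distinct `i`-th coordinates,
for some `i`. -/
lemma exists_coordinate_strictMono {d : ℕ} {S : Set (E d)} (hS : S.Infinite) (N : ℕ) :
    ∃ (i : Fin d) (q : ℕ → ℝ), StrictMonoOn q (Iio N) ∧ ∀ k < N, ∃ z ∈ S, z i = q k := by
  obtain ⟨i, hi⟩ : ∃ i : Fin d, ((fun z : E d => z i) '' S).Infinite := by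
    by_contra! hfin
    refine hS (((Set.Finite.pi' hfin).preimage
      (EuclideanSpace.equiv (Fin d) ℝ).injective.injOn).subset fun z hz i => ⟨z, hz, rfl⟩)
  obtain ⟨t, htS, htN⟩ := hi.exists_subset_card_eq N
  refine ⟨i, fun k => if h : k < N then t.orderEmbOfFin htN ⟨k, h⟩ else 0, ?_, fun k hk => ?_⟩
  · intro a ha b hb hab
    simp only [mem_Iio] at ha hb
    simpa [ha, hb] using hab
  · obtain ⟨z, hz, hzk⟩ := htS (t.orderEmbOfFin_mem htN ⟨k, hk⟩)
    exact ⟨z, hz, by simpa [hk] using hzk⟩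

/-- If a ReLU-invariant family `p : Ω → D(ℝᵈ)` (with `d ≥ 2`) contains a measure with
infinite support, then for every `m` there is a `δ > 0` such that every standard `m`-arc
carries some measure of the family which is `δ`-distributed on it. -/
theorem surjectivity_onto_arcs
    {n d : ℕ} (hd : 2 ≤ d) (Ω : Set (E n))
    (p : Ω → ProbabilityMeasure (E d))
    (hinv : ∀ f : E d → E d, IsReLULayer f → ∀ θ : Ω, ∃ ω : Ω,
      (p ω : Measure (E d)) = (p θ : Measure (E d)).map f)
    (θ₀ : Ω) (h₀ : (mSupport (p θ₀ : Measure (E d))).Infinite)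
    (m : ℕ) (hm : 0 < m) :
    ∃ δ : ℝ, 0 < δ ∧ ∀ r : Fin m → ℝ, IsStdScale r →
      ∃ θ : Ω, DeltaDistributed δ (p θ : Measure (E d)) r := by
  obtain ⟨i₀, q, hq, hqS⟩ := exists_coordinate_strictMono h₀ (3 * m)
  have hqle : ∀ {a b}, a ≤ b → b < 3 * m → q a ≤ q b := fun hab hb =>
    hq.monotoneOn (lt_of_le_of_lt hab hb) hb hab
  have hqlt : ∀ {a b}, a < b → b < 3 * m → q a < q b := fun hab hb => hq (hab.trans hb) hb hab
  let U : Fin m → Set (E d) := fun i => {z | q (3 * i) < z i₀ ∧ z i₀ < q (3 * i + 2)}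
  have hU : ∀ i, 0 < (p θ₀ : Measure (E d)) (U i) := fun i => by
    obtain ⟨z, hz, hzq⟩ := hqS (3 * i + 1) (by omega)
    have hc : Continuous fun z : E d => z i₀ := by fun_prop
    refine hz (U i) ((isOpen_lt continuous_const hc).inter (isOpen_lt hc continuous_const))
      ⟨?_, ?_⟩ <;> rw [hzq]
    exacts [hqlt (by omega) (by omega), hqlt (by omega) (by omega)]
  obtain ⟨j, -, hj⟩ := Finset.exists_min_image Finset.univ
    (fun i => (p θ₀ : Measure (E d)) (U i)) ⟨⟨0, hm⟩, Finset.mem_univ _⟩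
  refine ⟨((p θ₀ : Measure (E d)) (U j)).toReal,
    ENNReal.toReal_pos (hU j).ne' (measure_ne_top _ _), fun r hr => ?_⟩
  obtain ⟨f, hf, hfA, hfi⟩ := exists_net_onto_arc hd hm hr.1 (IsReLUNet.coordinate i₀ (-q 0))
    (fun z => le_max_right _ _) (fun i => q (3 * i) - q 0) (fun i => q (3 * i + 2) - q 0)
    (fun i j hij hj => sub_le_sub_right (hqle (by omega) (by omega)) _)
    (fun j hj => sub_lt_sub_right (hqlt (by omega) (by omega)) _)
  obtain ⟨ω, hω⟩ := hf.exists_map_eq hinv θ₀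
  refine ⟨ω, hr, ?_, fun i => ?_⟩
  · rw [hω]
    exact mSupport_map_subset _ hf.continuous.measurable (isClosed_emb2_image_arcSet r) hfA
  · rw [hω, ENNReal.ofReal_toReal (measure_ne_top _ _)]
    refine ((hj i (Finset.mem_univ i)).trans (measure_mono fun z hz => ?_)).trans
      (Measure.le_map_apply hf.continuous.aemeasurable _)
    have h0 : q 0 ≤ q (3 * i) := hqle (by omega) (by omega)
    have hz' : max (z i₀ + -q 0) 0 = z i₀ - q 0 := by
      rw [max_eq_left (by linarith [hz.1])]
      ring
    refine hfi i z ?_ ?_ <;> rw [hz']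
    exacts [sub_le_sub_right hz.1.le _, sub_le_sub_right hz.2.le _]

end
end

section
/- Let μ be a Borel probability measure on ℝᵈ whose support is an infinite set. Then there exist W ∈ ℝ^{d×d} and b ∈ ℝᵈ such that the image of the ReLU layer f : ℝᵈ → ℝᵈ, f(x) = ϱ(Wx + b), is contained in span{e₁} and the support of the pushforward f_* μ is infinite. -/
open MeasureTheory Set

noncomputable section

/-- A continuous map sends the support of a measure into the support of its pushforward. -/
lemma image_mSupport_subset {X Y : Type*} [TopologicalSpace X] [MeasurableSpace X]
    [OpensMeasurableSpace X] [TopologicalSpace Y] [MeasurableSpace Y] [BorelSpace Y]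
    {f : X → Y} (hf : Continuous f) (μ : Measure X) :
    f '' mSupport μ ⊆ mSupport (μ.map f) := by
  rintro _ ⟨x, hx, rfl⟩ U hU hxU
  rw [Measure.map_apply hf.measurable hU.measurableSet]
  exact hx _ (hU.preimage hf) hxU

lemma reluLayer_single {d : ℕ} (i j : Fin d) (s : ℝ) (x : E d) :
    reluLayer (Matrix.single i j s) 0 x = EuclideanSpace.single i (max (s * x j) 0) := by
  ext k
  by_cases hk : k = i
  · subst hk
    simp [reluLayer, Matrix.single_mulVec]
  · simp [reluLayer, Matrix.single_mulVec, hk]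

/-- An infinite set of vectors has infinite image under the positive or the negative part of
some coordinate. -/
lemma exists_infinite_image_max {d : ℕ} {S : Set (E d)} (hS : S.Infinite) :
    ∃ (j : Fin d) (s : ℝ), ((fun x : E d => max (s * x j) 0) '' S).Infinite := by
  by_contra! hfin
  have hcoord (j : Fin d) : ((fun x : E d => x j) '' S).Finite := by
    refine ((hfin j 1).image2 (fun a b : ℝ => a - b) (hfin j (-1))).subset ?_
    rintro _ ⟨x, hx, rfl⟩
    refine ⟨_, ⟨x, hx, rfl⟩, _, ⟨x, hx, rfl⟩, ?_⟩
    rcases le_total 0 (x j) with h | h <;> simp [h]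
  refine hS (((Set.Finite.pi hcoord).preimage
    (f := fun x : E d => (fun j => x j)) ?_).subset ?_)
  · exact (WithLp.ofLp_injective 2).injOn
  · exact fun x hx j _ => ⟨x, hx, rfl⟩

/-- If a Borel probability measure `μ` on `ℝᵈ` has infinite support, then there is a
ReLU layer `f(x) = ϱ(Wx + b)` whose image is contained in `span{e₁}` and such that the
pushforward `f_* μ` still has infinite support. -/
theorem exists_relu_layer_image_span_infinite_support
    {d : ℕ} (hd : 0 < d) (μ : Measure (E d)) [IsProbabilityMeasure μ]
    (h : (mSupport μ).Infinite) :
    ∃ (W : Matrix (Fin d) (Fin d) ℝ) (b : Fin d → ℝ),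
      (∀ x : E d, reluLayer W b x ∈
        (Submodule.span ℝ {EuclideanSpace.single (⟨0, hd⟩ : Fin d) (1 : ℝ)} :
          Submodule ℝ (E d))) ∧
      (mSupport (μ.map (reluLayer W b))).Infinite := by
  obtain ⟨j, s, hjs⟩ := exists_infinite_image_max h
  refine ⟨Matrix.single ⟨0, hd⟩ j s, 0, fun x => ?_, ?_⟩
  · rw [reluLayer_single, Submodule.mem_span_singleton]
    exact ⟨max (s * x j) 0, by ext k; simp⟩
  · refine Set.Infinite.mono (image_mSupport_subset (continuous_reluLayer _ _) μ) ?_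
    refine Set.Infinite.of_image (fun y : E d => y ⟨0, hd⟩) ?_
    simpa [Set.image_image, reluLayer_single] using hjs

end
end

section
/- For m ≥ 2, let 0 = a₀ < a₁ < ⋯ < a_m < ∞ and 0 = b₀ < b₁ < ⋯ < b_m < ∞. Then there exist ReLU layers F₀, F₁, …, F_m : ℝ² → ℝ² (each of the form x ↦ ϱ(Wx + b) with W ∈ ℝ^{2×2}, b ∈ ℝ²) whose composition F = F_m ∘ ⋯ ∘ F₁ ∘ F₀ satisfies F(b_i, 0) = (a_i, 0) for all i = 0,…,m, and such that on the set {(x,0) : x ≥ 0} one has F(x,0) = (f(x),0) for a continuous, strictly increasing, piecewise linear function f : [0,∞) → [0,∞) that is affine on each interval [b_{i−1}, b_i]. -/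
open Set

noncomputable section

/-- `compFamily F k = F k ∘ F (k-1) ∘ ⋯ ∘ F 1 ∘ F 0`. -/
def compFamily {α : Type*} (F : ℕ → α → α) : ℕ → α → α
  | 0 => F 0
  | k + 1 => F (k + 1) ∘ compFamily F k

/-- The action of a ReLU layer on a point of the plane, in coordinates. -/
lemma reluLayer_mk2 (p q r s c d x y : ℝ) :
    reluLayer !![p, q; r, s] ![c, d] (mk2 x y) =
      mk2 (max (p * x + q * y + c) 0) (max (r * x + s * y + d) 0) := by
  ext i
  fin_cases i <;> simp [reluLayer, mk2, Matrix.mulVec, dotProduct, Fin.sum_univ_two]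

/-- The slope of the segment joining `(b i, a i)` to `(b (i + 1), a (i + 1))`. -/
def segmentSlope (a b : ℕ → ℝ) (i : ℕ) : ℝ := (a (i + 1) - a i) / (b (i + 1) - b i)

/-- The relative change of slope at the breakpoint `b (k + 1)`. -/
def slopeChange (a b : ℕ → ℝ) (k : ℕ) : ℝ := segmentSlope a b (k + 1) / segmentSlope a b k - 1

/-- The piecewise linear interpolation of `b i ↦ a i` with breakpoints `b 1, …, b k`. -/
def interpolant (a b : ℕ → ℝ) : ℕ → ℝ → ℝ
  | 0, x => segmentSlope a b 0 * x
  | k + 1, x =>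
    interpolant a b k x + slopeChange a b k * max (interpolant a b k x - a (k + 1)) 0

lemma continuous_interpolant (a b : ℕ → ℝ) (k : ℕ) : Continuous (interpolant a b k) := by
  induction k with
  | zero => exact continuous_const.mul continuous_id
  | succ k ih =>
    exact ih.add (continuous_const.mul ((ih.sub continuous_const).max continuous_const))

lemma strictMono_add_mul_max {c : ℝ} (hc : -1 < c) (t : ℝ) :
    StrictMono fun u : ℝ => u + c * max (u - t) 0 := by
  intro u v huv
  rcases le_total u t with hu | hu <;> rcases le_total v t with hv | hv
  · simpa [max_eq_right (sub_nonpos.2 hu), max_eq_right (sub_nonpos.2 hv)] using huv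
  · simp only [max_eq_right (sub_nonpos.2 hu), max_eq_left (sub_nonneg.2 hv)]
    rcases hv.eq_or_lt with rfl | hv
    · simpa using huv
    · nlinarith
  · linarith
  · simp only [max_eq_left (sub_nonneg.2 hu), max_eq_left (sub_nonneg.2 hv)]
    nlinarith

section Interpolation

variable {m : ℕ} {a b : ℕ → ℝ}

lemma le_of_forall_lt_succ (hbmono : ∀ i < m, b i < b (i + 1)) {i j : ℕ} (hij : i ≤ j)
    (hj : j ≤ m) : b i ≤ b j := by
  induction j, hij using Nat.le_induction with
  | base => exact le_rfl
  | succ j _ ih => exact (ih (Nat.le_of_succ_le hj)).trans (hbmono j hj).le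

lemma segmentSlope_pos (hamono : ∀ i < m, a i < a (i + 1)) (hbmono : ∀ i < m, b i < b (i + 1))
    {i : ℕ} (hi : i < m) : 0 < segmentSlope a b i :=
  div_pos (sub_pos.2 (hamono i hi)) (sub_pos.2 (hbmono i hi))

lemma segmentSlope_mul_sub {i : ℕ} (hi : b i < b (i + 1)) :
    segmentSlope a b i * (b (i + 1) - b i) = a (i + 1) - a i :=
  div_mul_cancel₀ _ (sub_pos.2 hi).ne'

lemma strictMono_interpolant (hamono : ∀ i < m, a i < a (i + 1))
    (hbmono : ∀ i < m, b i < b (i + 1)) {k : ℕ} (hk : k < m) :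
    StrictMono (interpolant a b k) := by
  induction k with
  | zero => exact strictMono_mul_left_of_pos (segmentSlope_pos hamono hbmono hk)
  | succ k ih =>
    have hc : -1 < slopeChange a b k := by
      have := div_pos (segmentSlope_pos hamono hbmono hk)
        (segmentSlope_pos hamono hbmono (Nat.lt_of_succ_lt hk))
      unfold slopeChange
      linarith
    exact (strictMono_add_mul_max hc (a (k + 1))).comp (ih (Nat.lt_of_succ_lt hk))

/-- Beyond its last breakpoint the interpolant is affine. -/
lemma interpolant_of_ge (ha0 : a 0 = 0) (hb0 : b 0 = 0) (hamono : ∀ i < m, a i < a (i + 1))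
    (hbmono : ∀ i < m, b i < b (i + 1)) {k : ℕ} (hk : k < m) {x : ℝ} (hx : b k ≤ x) :
    interpolant a b k x = a k + segmentSlope a b k * (x - b k) := by
  induction k with
  | zero => simp [interpolant, ha0, hb0]
  | succ k ih =>
    have hk' : k < m := Nat.lt_of_succ_lt hk
    have hs := segmentSlope_pos hamono hbmono hk'
    have hsub := segmentSlope_mul_sub (a := a) (hbmono k hk')
    have hg : interpolant a b k x = a (k + 1) + segmentSlope a b k * (x - b (k + 1)) := by
      rw [ih hk' ((hbmono k hk').le.trans hx)]
      linear_combination hsub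
    have hmax : 0 ≤ interpolant a b k x - a (k + 1) := by
      rw [hg, add_sub_cancel_left]
      exact mul_nonneg hs.le (sub_nonneg.2 hx)
    rw [interpolant, max_eq_left hmax, hg, slopeChange]
    field_simp
    ring

/-- The interpolant is affine between consecutive breakpoints. -/
lemma interpolant_of_mem_Icc (ha0 : a 0 = 0) (hb0 : b 0 = 0)
    (hamono : ∀ i < m, a i < a (i + 1)) (hbmono : ∀ i < m, b i < b (i + 1))
    {k : ℕ} (hk : k < m) {i : ℕ} (hi : i ≤ k) {x : ℝ} (hx : x ∈ Set.Icc (b i) (b (i + 1))) :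
    interpolant a b k x = a i + segmentSlope a b i * (x - b i) := by
  induction k, hi using Nat.le_induction with
  | base => exact interpolant_of_ge ha0 hb0 hamono hbmono hk hx.1
  | succ k hik ih =>
    have hk' : k < m := Nat.lt_of_succ_lt hk
    have hb : b (i + 1) ≤ b (k + 1) :=
      le_of_forall_lt_succ hbmono (Nat.succ_le_succ hik) hk.le
    have hend : interpolant a b k (b (k + 1)) = a (k + 1) := by
      rw [interpolant_of_ge ha0 hb0 hamono hbmono hk' (hbmono k hk').le,
        segmentSlope_mul_sub (hbmono k hk')]
      ring
    have hle : interpolant a b k x ≤ a (k + 1) :=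
      hend ▸ (strictMono_interpolant hamono hbmono hk').monotone (hx.2.trans hb)
    rw [interpolant, max_eq_right (sub_nonpos.2 hle), mul_zero, add_zero, ih hk']

lemma interpolant_apply_zero (ha0 : a 0 = 0) (hb0 : b 0 = 0)
    (hamono : ∀ i < m, a i < a (i + 1)) (hbmono : ∀ i < m, b i < b (i + 1))
    {k : ℕ} (hk : k < m) : interpolant a b k 0 = 0 := by
  have hpos : 0 < b 1 := by simpa [hb0] using hbmono 0 (Nat.zero_lt_of_lt hk)
  rw [interpolant_of_mem_Icc ha0 hb0 hamono hbmono hk k.zero_le ⟨hb0.le, hpos.le⟩]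
  simp [ha0, hb0]

lemma interpolant_nonneg (ha0 : a 0 = 0) (hb0 : b 0 = 0)
    (hamono : ∀ i < m, a i < a (i + 1)) (hbmono : ∀ i < m, b i < b (i + 1))
    {k : ℕ} (hk : k < m) {x : ℝ} (hx : 0 ≤ x) : 0 ≤ interpolant a b k x :=
  interpolant_apply_zero ha0 hb0 hamono hbmono hk ▸
    (strictMono_interpolant hamono hbmono hk).monotone hx

lemma interpolant_apply_node (ha0 : a 0 = 0) (hb0 : b 0 = 0)
    (hamono : ∀ i < m, a i < a (i + 1)) (hbmono : ∀ i < m, b i < b (i + 1))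
    {k : ℕ} (hk : k < m) {i : ℕ} (hi : i ≤ k + 1) : interpolant a b k (b i) = a i := by
  rcases i with _ | i
  · rw [hb0, ha0, interpolant_apply_zero ha0 hb0 hamono hbmono hk]
  · have hb := hbmono i (hi.trans hk)
    rw [interpolant_of_mem_Icc ha0 hb0 hamono hbmono hk (Nat.le_of_succ_le_succ hi)
      ⟨hb.le, le_rfl⟩, segmentSlope_mul_sub hb]
    ring

end Interpolation

/-- The hidden layers: the `k`-th one produces `interpolant a b k` in its first coordinate and the
part of it exceeding `a (k + 1)` in its second one. -/
def hiddenLayer (a b : ℕ → ℝ) : ℕ → E 2 → E 2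
  | 0 => reluLayer !![segmentSlope a b 0, 0; segmentSlope a b 0, 0] ![0, -a 1]
  | k + 1 => reluLayer !![1, slopeChange a b k; 1, slopeChange a b k] ![0, -a (k + 2)]

lemma isReLULayer_hiddenLayer (a b : ℕ → ℝ) (k : ℕ) : IsReLULayer (hiddenLayer a b k) := by
  cases k <;> exact ⟨_, _, rfl⟩

lemma compFamily_hiddenLayer {m : ℕ} {a b : ℕ → ℝ} (ha0 : a 0 = 0) (hb0 : b 0 = 0)
    (hamono : ∀ i < m, a i < a (i + 1)) (hbmono : ∀ i < m, b i < b (i + 1))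
    {k : ℕ} (hk : k < m) {x : ℝ} (hx : 0 ≤ x) :
    compFamily (hiddenLayer a b) k (mk2 x 0) =
      mk2 (interpolant a b k x) (max (interpolant a b k x - a (k + 1)) 0) := by
  have hnn := interpolant_nonneg ha0 hb0 hamono hbmono hk hx
  induction k with
  | zero =>
    rw [interpolant] at hnn ⊢
    simp [compFamily, hiddenLayer, reluLayer_mk2, max_eq_left hnn, sub_eq_add_neg]
  | succ k ih =>
    have hk' := Nat.lt_of_succ_lt hk
    rw [compFamily, Function.comp_apply,
      ih hk' (interpolant_nonneg ha0 hb0 hamono hbmono hk' hx)]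
    rw [interpolant] at hnn ⊢
    simp only [hiddenLayer, reluLayer_mk2, one_mul, add_zero, max_eq_left hnn, ← sub_eq_add_neg]

lemma compFamily_congr {α : Type*} {F G : ℕ → α → α} {k : ℕ} (h : ∀ j ≤ k, F j = G j) :
    compFamily F k = compFamily G k := by
  induction k with
  | zero => exact h 0 le_rfl
  | succ k ih => rw [compFamily, compFamily, h _ le_rfl, ih fun j hj => h j (hj.trans k.le_succ)]

/-- Resizing the line segments:  for `m ≥ 2` and breakpoints
`0 = a₀ < a₁ < ⋯ < a_m` and `0 = b₀ < b₁ < ⋯ < b_m` there are ReLU layers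
`F₀, …, F_m : ℝ² → ℝ²` whose composition `F = F_m ∘ ⋯ ∘ F₀` maps `(bᵢ, 0)` to `(aᵢ, 0)`
and acts on `{(x, 0) : x ≥ 0}` as `(x, 0) ↦ (f x, 0)` for a continuous, strictly
increasing function `f ≥ 0` which is affine on each interval `[b_{i-1}, b_i]`. -/
theorem exists_relu_layers_resizing_segments
    {m : ℕ} (hm : 2 ≤ m) (a b : ℕ → ℝ)
    (ha0 : a 0 = 0) (hb0 : b 0 = 0)
    (hamono : ∀ i < m, a i < a (i + 1)) (hbmono : ∀ i < m, b i < b (i + 1)) :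
    ∃ F : ℕ → E 2 → E 2,
      (∀ j ≤ m, IsReLULayer (F j)) ∧
      (∀ i ≤ m, compFamily F m (mk2 (b i) 0) = mk2 (a i) 0) ∧
      ∃ f : ℝ → ℝ,
        (∀ x : ℝ, 0 ≤ x → compFamily F m (mk2 x 0) = mk2 (f x) 0) ∧
        (∀ x : ℝ, 0 ≤ x → 0 ≤ f x) ∧
        ContinuousOn f (Set.Ici 0) ∧
        StrictMonoOn f (Set.Ici 0) ∧
        (∀ i : ℕ, 1 ≤ i → i ≤ m →
          ∃ c e : ℝ, ∀ x ∈ Set.Icc (b (i - 1)) (b i), f x = c * x + e) := by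
  obtain ⟨n, rfl⟩ : ∃ n, m = n + 1 := ⟨m - 1, by omega⟩
  have hn := n.lt_succ_self
  have hbnn : ∀ i ≤ n + 1, 0 ≤ b i := fun i hi =>
    hb0 ▸ le_of_forall_lt_succ hbmono i.zero_le hi
  set F : ℕ → E 2 → E 2 :=
    Function.update (hiddenLayer a b) (n + 1) (reluLayer !![1, 0; 0, 0] ![0, 0]) with hF
  have hcomp : ∀ x : ℝ, 0 ≤ x → compFamily F (n + 1) (mk2 x 0) = mk2 (interpolant a b n x) 0 := by
    intro x hx
    have hcongr : compFamily F n = compFamily (hiddenLayer a b) n :=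
      compFamily_congr fun j hj => Function.update_of_ne (by omega) _ _
    rw [compFamily, Function.comp_apply, hcongr,
      compFamily_hiddenLayer ha0 hb0 hamono hbmono hn hx, hF, Function.update_self, reluLayer_mk2]
    simp [max_eq_left (interpolant_nonneg ha0 hb0 hamono hbmono hn hx)]
  refine ⟨F, fun j _ => ?_, fun i hi => ?_, interpolant a b n, hcomp,
    fun x hx => interpolant_nonneg ha0 hb0 hamono hbmono hn hx,
    (continuous_interpolant a b n).continuousOn,
    (strictMono_interpolant hamono hbmono hn).strictMonoOn _, fun i hi1 him => ?_⟩
  · by_cases hj : j = n + 1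
    · rw [hF, hj, Function.update_self]
      exact ⟨_, _, rfl⟩
    · rw [hF, Function.update_of_ne hj]
      exact isReLULayer_hiddenLayer a b j
  · rw [hcomp _ (hbnn i hi), interpolant_apply_node ha0 hb0 hamono hbmono hn hi]
  · obtain ⟨i, rfl⟩ := Nat.exists_eq_add_of_le' hi1
    refine ⟨segmentSlope a b i, a i - segmentSlope a b i * b i, fun x hx => ?_⟩
    rw [interpolant_of_mem_Icc ha0 hb0 hamono hbmono hn (Nat.le_of_succ_le_succ him) hx]
    ring

end
end

section
/- Let m ∈ ℕ and let A₁, A₂ be standard m-arcs with scaling factors (r₁¹,…,r_m¹) and (r₁²,…,r_m²) respectively. Then max_{i=1,…,m} |r_i¹ − r_i²| ≤ 2 · d_A(A₁, A₂), where d_A(A₁, A₂) = max_{i=0,…,m} ‖v_i¹ − v_i²‖₂ is the maximal Euclidean distance between corresponding vertices. That is, the map from standard m-arcs to their scaling-factor vectors is Lipschitz continuous with constant 2 with respect to d_A and the ℓ∞-norm on ℝ₊ᵐ. -/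
open MeasureTheory Set

noncomputable section

theorem norm_mk2_sin_cos (θ : ℝ) : ‖mk2 (Real.sin θ) (Real.cos θ)‖ = 1 := by
  simp [mk2, EuclideanSpace.norm_eq, Fin.sum_univ_two]

theorem arcVertex_succ {m : ℕ} (r : Fin m → ℝ) (i : Fin m) :
    arcVertex r i.succ = arcVertex r i.castSucc +
      r i • mk2 (Real.sin (((i : ℕ) + 1) * arcAngle m)) (Real.cos (((i : ℕ) + 1) * arcAngle m)) := by
  have h : (Finset.univ.filter fun j : Fin m => (j : ℕ) < (i.succ : Fin (m + 1))) =
      insert i (Finset.univ.filter fun j : Fin m => (j : ℕ) < (i.castSucc : Fin (m + 1))) := by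
    ext j
    simp only [Finset.mem_filter, Finset.mem_insert, Finset.mem_univ, true_and, Fin.val_succ,
      Fin.val_castSucc, Fin.ext_iff]
    omega
  unfold arcVertex
  rw [h, Finset.sum_insert (by simp), add_comm]

/-- The map from a standard `m`-arc to its vector of scaling factors is Lipschitz with
constant `2`: for standard `m`-arcs `A₁, A₂` with scaling factors `r₁, r₂`,
`max_i |r₁ i - r₂ i| ≤ 2 · d_A(A₁, A₂)`, where `d_A` is the maximal Euclidean distance
between corresponding vertices. -/
theorem scale_lipschitz_of_arcs
    {m : ℕ} (r₁ r₂ : Fin m → ℝ) (h₁ : IsStdScale r₁) (h₂ : IsStdScale r₂) :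
    ∀ i : Fin m, |r₁ i - r₂ i| ≤
      2 * ⨆ k : Fin (m + 1), dist (arcVertex r₁ k) (arcVertex r₂ k) := by
  intro i
  set w := mk2 (Real.sin (((i : ℕ) + 1) * arcAngle m)) (Real.cos (((i : ℕ) + 1) * arcAngle m))
    with hw
  have hdiff : (r₁ i - r₂ i) • w = (arcVertex r₁ i.succ - arcVertex r₂ i.succ) -
      (arcVertex r₁ i.castSucc - arcVertex r₂ i.castSucc) := by
    rw [arcVertex_succ, arcVertex_succ, ← hw, sub_smul]
    abel
  have hle (k : Fin (m + 1)) : ‖arcVertex r₁ k - arcVertex r₂ k‖ ≤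
      ⨆ k : Fin (m + 1), dist (arcVertex r₁ k) (arcVertex r₂ k) := by
    rw [← dist_eq_norm]
    exact le_ciSup (f := fun k => dist (arcVertex r₁ k) (arcVertex r₂ k))
      (Set.finite_range _).bddAbove k
  calc |r₁ i - r₂ i| = ‖(r₁ i - r₂ i) • w‖ := by
        rw [norm_smul, hw, norm_mk2_sin_cos, mul_one, Real.norm_eq_abs]
    _ ≤ ‖arcVertex r₁ i.succ - arcVertex r₂ i.succ‖ +
        ‖arcVertex r₁ i.castSucc - arcVertex r₂ i.castSucc‖ := hdiff ▸ norm_sub_le _ _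
    _ ≤ _ := by linarith [hle i.succ, hle i.castSucc]

end
end

section
/- Every one-dimensional ReLU network equals a three-layer one-dimensional ReLU network: for every L ∈ ℕ and all weights w₁,…,w_L ∈ ℝ and biases b₁,…,b_L ∈ ℝ, defining f_i(x) = ϱ(w_i x + b_i) and f = f_L ∘ ⋯ ∘ f₁, there exist w'₁, w'₂, w'₃, b'₁, b'₂, b'₃ ∈ ℝ such that with g_j(x) = ϱ(w'_j x + b'_j) one has f = g₃ ∘ g₂ ∘ g₁ as functions ℝ → ℝ. -/
/-- The composition `f_L ∘ ⋯ ∘ f_1` of the one-dimensional ReLU layers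
`f_{k+1}(x) = max (w k * x + b k) 0`. -/
noncomputable def net1 (w b : ℕ → ℝ) : ℕ → ℝ → ℝ
  | 0 => id
  | L + 1 => (fun x => max (w L * x + b L) 0) ∘ net1 w b L

/-- A nonnegative affine function clamped from below, and possibly also from above. -/
def IsClampedAffine (f : ℝ → ℝ) : Prop :=
  ∃ a e c : ℝ, 0 ≤ c ∧
    ((∀ x, f x = max c (a * x + e)) ∨ ∃ d, c ≤ d ∧ ∀ x, f x = min d (max c (a * x + e)))

theorem IsClampedAffine.reluLayer_comp {f : ℝ → ℝ} (hf : IsClampedAffine f) (w b : ℝ) :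
    IsClampedAffine fun x => max (w * f x + b) 0 := by
  obtain ⟨a, e, c, -, hf | ⟨d, hcd, hf⟩⟩ := hf
  · rcases le_total 0 w with hw | hw
    · refine ⟨w * a, w * e + b, max (w * c + b) 0, le_max_right _ _, Or.inl fun x => ?_⟩
      have h : w * a * x + (w * e + b) = w * (a * x + e) + b := by ring
      simp only [hf, mul_max_of_nonneg _ _ hw, h]
      grind
    · refine ⟨w * a, w * e + b, 0, le_rfl,
        Or.inr ⟨max (w * c + b) 0, le_max_right _ _, fun x => ?_⟩⟩
      have h : w * a * x + (w * e + b) = w * (a * x + e) + b := by ring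
      have hm : w * max c (a * x + e) = min (w * c) (w * (a * x + e)) :=
        (antitone_mul_left hw).map_max
      simp only [hf, hm, h]
      grind
  · rcases le_total 0 w with hw | hw
    · have hle : w * c ≤ w * d := mul_le_mul_of_nonneg_left hcd hw
      refine ⟨w * a, w * e + b, max (w * c + b) 0, le_max_right _ _,
        Or.inr ⟨max (w * d + b) 0, by gcongr, fun x => ?_⟩⟩
      have h : w * a * x + (w * e + b) = w * (a * x + e) + b := by ring
      simp only [hf, mul_min_of_nonneg _ _ hw, mul_max_of_nonneg _ _ hw, h]
      grind
    · have hle : w * d ≤ w * c := mul_le_mul_of_nonpos_left hcd hw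
      refine ⟨w * a, w * e + b, max (w * d + b) 0, le_max_right _ _,
        Or.inr ⟨max (w * c + b) 0, by gcongr, fun x => ?_⟩⟩
      have h : w * a * x + (w * e + b) = w * (a * x + e) + b := by ring
      have hmin : w * min d (max c (a * x + e)) = max (w * d) (w * max c (a * x + e)) :=
        (antitone_mul_left hw).map_min
      have hmax : w * max c (a * x + e) = min (w * c) (w * (a * x + e)) :=
        (antitone_mul_left hw).map_max
      simp only [hf, hmin, hmax, h]
      grind

theorem isClampedAffine_net1_succ (w b : ℕ → ℝ) (L : ℕ) :
    IsClampedAffine (net1 w b (L + 1)) := by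
  induction L with
  | zero => exact ⟨w 0, b 0, 0, le_rfl, Or.inl fun x => max_comm _ _⟩
  | succ L ih => exact ih.reluLayer_comp (w (L + 1)) (b (L + 1))

theorem IsClampedAffine.exists_three_layers {f : ℝ → ℝ} (hf : IsClampedAffine f) :
    ∃ w' b' : Fin 3 → ℝ, ∀ x : ℝ,
      f x = max (w' 2 * max (w' 1 * max (w' 0 * x + b' 0) 0 + b' 1) 0 + b' 2) 0 := by
  obtain ⟨a, e, c, hc, hf | ⟨d, hcd, hf⟩⟩ := hf
  · refine ⟨![a, 1, 1], ![e - c, 0, c], fun x => ?_⟩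
    simp only [hf, Matrix.cons_val]
    grind
  · refine ⟨![a, -1, -1], ![e - c, d - c, d], fun x => ?_⟩
    simp only [hf, Matrix.cons_val]
    grind

/-- Every one-dimensional ReLU network (with `L ≥ 1` layers) can be written as a
three-layer one-dimensional ReLU network. -/
theorem one_dim_relu_network_eq_three_layers
    (L : ℕ) (hL : 1 ≤ L) (w b : ℕ → ℝ) :
    ∃ w' b' : Fin 3 → ℝ, ∀ x : ℝ,
      net1 w b L x =
        max (w' 2 * max (w' 1 * max (w' 0 * x + b' 0) 0 + b' 1) 0 + b' 2) 0 := by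
  obtain ⟨n, rfl⟩ := Nat.exists_eq_add_of_le' hL
  exact (isClampedAffine_net1_succ w b n).exists_three_layers
end

section
/- There exists a continuous function Γ : ℝ → ℝ^ω (where ℝ^ω = ℝ^ℕ carries the product topology) whose range is exactly ℝ^∞, the set of real sequences that are eventually zero. In particular, Γ is a continuous surjection from ℝ onto ℝ^∞. -/
/-- A continuous family of real sequences, parametrized by the unit interval, that attains every
sequence in the Hilbert cube `[-1, 1]^ℕ`. -/
theorem exists_continuous_unitInterval_covering_cube :
    ∃ G : ℝ → ℕ → ℝ, Continuous G ∧
      ∀ y : ℕ → ℝ, (∀ i, |y i| ≤ 1) → ∃ s ∈ Set.Icc (0 : ℝ) 1, G s = y := by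
  let g : C(cantorSet, ℕ → ℝ) :=
    ⟨fun c i => 2 * (cantorToHilbert (cantorSetHomeomorphNatToBool c) i : ℝ) - 1, by
      have := cantorToHilbert_continuous
      fun_prop⟩
  obtain ⟨G, hG⟩ := g.exists_restrict_eq isClosed_cantorSet
  refine ⟨G, G.continuous, fun y hy => ?_⟩
  obtain ⟨b, hb⟩ := cantorToHilbert_surjective fun i => ⟨(y i + 1) / 2, by
    constructor <;> linarith [abs_le.1 (hy i)]⟩
  refine ⟨cantorSetHomeomorphNatToBool.symm b, cantorSet_subset_unitInterval (Subtype.prop _), ?_⟩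
  have h := DFunLike.congr_fun hG (cantorSetHomeomorphNatToBool.symm b)
  refine h.trans ?_
  ext i
  simp [g, hb, mul_div_cancel₀]

/-- The continuous distance to the nearest integer. -/
theorem continuous_min_fract_one_sub_fract :
    Continuous fun t : ℝ => min (Int.fract t) (1 - Int.fract t) := by
  have h : ContinuousOn (fun s : ℝ => min s (1 - s)) (Set.Icc 0 1) := by fun_prop
  exact h.comp_fract'' (by simp)

/-- There is a continuous map `Γ : ℝ → ℝ^ω` (the countable product `ℕ → ℝ` with the
product topology) whose range is exactly `ℝ^∞`, the set of sequences with only finitely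
many non-zero entries; in particular `Γ` is a continuous surjection onto `ℝ^∞`. -/
theorem exists_continuous_map_onto_eventually_zero_sequences :
    ∃ Γ : ℝ → (ℕ → ℝ), Continuous Γ ∧
      Set.range Γ = {x : ℕ → ℝ | {i : ℕ | x i ≠ 0}.Finite} := by
  obtain ⟨G, hG, hcov⟩ := exists_continuous_unitInterval_covering_cube
  let ρ : ℝ → ℝ := fun t => min (Int.fract t) (1 - Int.fract t)
  have hρ : Continuous ρ := continuous_min_fract_one_sub_fract
  have hρ_nonneg (t : ℝ) : 0 ≤ ρ t :=
    le_min (Int.fract_nonneg t) (sub_nonneg.2 (Int.fract_lt_one t).le)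
  refine ⟨fun t i => min 1 (max 0 (t - ρ t - i)) * ((t - ρ t) * G (2 * ρ t) i),
    by fun_prop, Set.Subset.antisymm ?_ fun x hx => ?_⟩
  · rintro _ ⟨t, rfl⟩
    refine (Set.finite_lt_nat ⌈t⌉₊).subset fun i hi => ?_
    by_contra hlt
    have hti : t ≤ i := Nat.ceil_le.1 (not_lt.1 hlt)
    have : t - ρ t - i ≤ 0 := by linarith [hρ_nonneg t]
    exact hi (by simp [max_eq_left this])
  · have hfin : {i : ℕ | x i ≠ 0}.Finite := hx
    obtain ⟨n, hn⟩ := (hfin.image fun i => max (i + 1) ⌈|x i|⌉₊).bddAbove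
    have hbound (i : ℕ) (hi : x i ≠ 0) : i + 1 ≤ n ∧ |x i| ≤ n := by
      have := max_le_iff.1 (hn (Set.mem_image_of_mem _ hi))
      exact ⟨this.1, Nat.ceil_le.1 this.2⟩
    obtain ⟨s, ⟨hs0, hs1⟩, hs⟩ := hcov (fun i => x i / n) fun i => by
      rw [abs_div, Nat.abs_cast]
      by_cases hi : x i = 0
      · simp [hi]
      · exact div_le_one_of_le₀ (hbound i hi).2 n.cast_nonneg
    have hfract : Int.fract ((n : ℝ) + s / 2) = s / 2 := by
      rw [Int.fract_natCast_add, Int.fract_eq_self]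
      constructor <;> linarith
    have hρs : ρ (n + s / 2) = s / 2 := by
      simp only [ρ, hfract]
      exact min_eq_left (by linarith)
    refine ⟨n + s / 2, funext fun i => ?_⟩
    simp only [hρs, add_sub_cancel_right, mul_div_cancel₀ s (two_ne_zero' ℝ), hs]
    by_cases hi : x i = 0
    · simp [hi]
    · have hin : (i : ℝ) + 1 ≤ n := mod_cast (hbound i hi).1
      have hn0 : (n : ℝ) ≠ 0 := by linarith [(i.cast_nonneg : (0 : ℝ) ≤ i)]
      rw [min_eq_left (le_max_of_le_right (by linarith)), one_mul, mul_div_cancel₀ _ hn0]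
end
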